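/- Let H(t,q,p) : ℝ × ℝ^d × ℝ^d → ℝ be a C² Hamiltonian such that ‖d²H(t,q,p)‖ ≤ M for all (t,q,p), for some constant M > 0. Let u₀ : ℝ^d → ℝ be differentiable with globally Lipschitz differential, with Lipschitz constant Lip(du₀), and set T = ( 4M(1 + Lip(du₀)) )^{-1}. Then there exists a solution u(t,q) : (−T, T) × ℝ^d → ℝ of the Hamilton–Jacobi equation (HJ), differentiable with locally Lipschitz differential, such that u(0,q) = u₀(q) for all q, and moreover for every t with |t| < T, the map q ↦ ∂_q u(t,q) is Lipschitz with Lip(∂_q u(t,·)) ≤ Lip(du₀) + 4|t| M (1 + Lip(du₀))². -/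

import Mathlib

open scoped RealInnerProductSpace NNReal
open Set Metric
open scoped Topology
open InnerProductSpace Asymptotics Filter

section Calculus

variable {V : Type*} [NormedAddCommGroup V] [NormedSpace ℝ V]

theorem norm_fderiv_sub_le_of_norm_iteratedFDeriv_two_le {F : V → ℝ} (hF : ContDiff ℝ 2 F) {M : ℝ}
    (hM : ∀ x, ‖iteratedFDeriv ℝ 2 F x‖ ≤ M) (x y : V) :
    ‖fderiv ℝ F y - fderiv ℝ F x‖ ≤ M * ‖y - x‖ := by
  have hd : Differentiable ℝ (fderiv ℝ F) :=
    (hF.fderiv_right (m := 1) (by norm_num)).differentiable (by norm_num)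
  refine convex_univ.norm_image_sub_le_of_norm_fderiv_le (fun z _ => hd z) (fun z _ => ?_)
    (mem_univ x) (mem_univ y)
  rw [← norm_iteratedFDeriv_one, norm_iteratedFDeriv_fderiv]
  exact hM z

/-- First-order Taylor estimate for a function with Lipschitz differential. -/
theorem abs_taylor_remainder_le {F : V → ℝ} (hF : Differentiable ℝ F) {M : ℝ} (hM : 0 ≤ M)
    (hlip : ∀ x y, ‖fderiv ℝ F y - fderiv ℝ F x‖ ≤ M * ‖y - x‖) (x y : V) :
    |F y - F x - fderiv ℝ F x (y - x)| ≤ M * ‖y - x‖ ^ 2 := by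
  have hball : Convex ℝ (closedBall x ‖y - x‖) := convex_closedBall _ _
  have h := hball.norm_image_sub_le_of_norm_fderiv_le' (f := F) (φ := fderiv ℝ F x)
    (C := M * ‖y - x‖) (x := x) (y := y) (fun z _ => hF z) (fun z hz => ?_)
    (mem_closedBall_self (norm_nonneg _)) (by simp [dist_eq_norm])
  · rw [Real.norm_eq_abs] at h
    linarith
  · rw [mem_closedBall, dist_eq_norm] at hz
    exact (hlip x z).trans (by gcongr)

theorem exists_primitive_on_Icc {T : ℝ} (hT : 0 ≤ T) {f : ℝ → ℝ}
    (hf : ContinuousOn f (Icc (-T) T)) (c : ℝ) :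
    ∃ A : ℝ → ℝ, A 0 = c ∧ ∀ t ∈ Icc (-T) T, HasDerivWithinAt A (f t) (Icc (-T) T) t := by
  have hle : -T ≤ T := by linarith
  have hg : Continuous (IccExtend hle ((Icc (-T) T).domRestrict f)) :=
    hf.domRestrict.Icc_extend'
  refine ⟨fun t => c + ∫ s in (0 : ℝ)..t, IccExtend hle ((Icc (-T) T).domRestrict f) s, by simp,
    fun t ht => ?_⟩
  have h := (hg.integral_hasStrictDerivAt 0 t).hasDerivAt.hasDerivWithinAt (s := Icc (-T) T)
  rw [IccExtend_of_mem _ _ ht] at h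
  exact h.const_add c

/-- A curve with `‖D'‖ ≤ M ‖D‖` on a short interval stays close to its initial value. -/
theorem norm_sub_le_of_norm_deriv_le_mul_norm {T M : ℝ} (hM : 0 ≤ M) (hMT : M * T ≤ 1 / 4)
    {D D' : ℝ → V} (hD : ∀ t ∈ Icc (-T) T, HasDerivWithinAt D (D' t) (Icc (-T) T) t)
    (hb : ∀ t ∈ Icc (-T) T, ‖D' t‖ ≤ M * ‖D t‖) {t : ℝ} (ht : t ∈ Icc (-T) T) :
    ‖D t - D 0‖ ≤ 4 / 3 * (M * |t|) * ‖D 0‖ ∧ ‖D t‖ ≤ 4 / 3 * ‖D 0‖ := by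
  have htT : |t| ≤ T := abs_le.2 ht
  set J := Icc (-|t|) |t| with hJ
  have hJI : J ⊆ Icc (-T) T := Icc_subset_Icc (by linarith) htT
  have h0J : (0 : ℝ) ∈ J := by simp [hJ]
  have htJ : t ∈ J := ⟨neg_abs_le t, le_abs_self t⟩
  have hcont : ContinuousOn (fun s => ‖D s‖) J :=
    (fun s hs => ((hD s (hJI hs)).continuousWithinAt.mono hJI).norm)
  obtain ⟨s₀, hs₀, hmax⟩ := isCompact_Icc.exists_isMaxOn ⟨0, h0J⟩ hcont
  have hmv : ∀ s ∈ J, ‖D s - D 0‖ ≤ M * ‖D s₀‖ * |t| := by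
    intro s hs
    have h := (convex_Icc (-|t|) |t|).norm_image_sub_le_of_norm_hasDerivWithin_le
      (C := M * ‖D s₀‖) (fun r hr => (hD r (hJI hr)).mono hJI)
      (fun r hr => (hb r (hJI hr)).trans (mul_le_mul_of_nonneg_left (hmax hr) hM)) h0J hs
    refine h.trans ?_
    have : ‖s - 0‖ ≤ |t| := by simpa using abs_le.2 hs
    gcongr
  have hMt : M * |t| ≤ 1 / 4 := (mul_le_mul_of_nonneg_left htT hM).trans hMT
  have hMt0 : 0 ≤ M * |t| := by positivity
  have hS : ‖D s₀‖ ≤ 4 / 3 * ‖D 0‖ := by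
    have h1 := hmv s₀ hs₀
    have h2 : ‖D s₀‖ ≤ ‖D s₀ - D 0‖ + ‖D 0‖ := by simpa using norm_add_le (D s₀ - D 0) (D 0)
    nlinarith [norm_nonneg (D s₀)]
  refine ⟨(hmv t htJ).trans ?_, (hmax htJ).trans hS⟩
  nlinarith [norm_nonneg (D s₀)]

/-- Existence of integral curves on a short interval for a globally Lipschitz field. -/
theorem exists_integralCurve_on_Icc [CompleteSpace V] {T M : ℝ} (hT : 0 ≤ T) (hM : 0 ≤ M)
    (hMT : M * T ≤ 1 / 4) {X : ℝ → V → V}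
    (hlip : ∀ t z w, ‖X t z - X t w‖ ≤ M * ‖z - w‖) (hcont : ∀ z, Continuous fun t => X t z)
    (z₀ : V) :
    ∃ Z : ℝ → V, Z 0 = z₀ ∧
      ∀ t ∈ Icc (-T) T, HasDerivWithinAt Z (X t (Z t)) (Icc (-T) T) t := by
  obtain ⟨B, hB⟩ := (isCompact_Icc (a := -T) (b := T)).exists_bound_of_continuousOn
    (hcont z₀).continuousOn
  have h0 : (0 : ℝ) ∈ Icc (-T) T := ⟨by linarith, hT⟩
  have hB0 : 0 ≤ B := (norm_nonneg _).trans (hB 0 h0)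
  lift B to ℝ≥0 using hB0
  lift M to ℝ≥0 using hM
  lift T to ℝ≥0 using hT
  have hPL : IsPicardLindelof X (tmin := -T) (tmax := T) ⟨0, h0⟩ z₀ (2 * B * T) 0
      (B + M * (2 * B * T)) M := by
    refine ⟨fun t _ => ?_, fun z _ => (hcont z).continuousOn, fun t ht z hz => ?_, ?_⟩
    · exact LipschitzOnWith.of_dist_le_mul fun z _ w _ => by
        simpa [dist_eq_norm] using hlip t z w
    · have h1 : ‖X t z‖ ≤ ‖X t z - X t z₀‖ + ‖X t z₀‖ := by
        simpa using norm_add_le (X t z - X t z₀) (X t z₀)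
      have h2 : ‖X t z - X t z₀‖ ≤ M * (2 * B * T) := by
        refine (hlip t z z₀).trans ?_
        rw [mem_closedBall, dist_eq_norm] at hz
        push_cast at hz
        gcongr
      push_cast
      linarith [hB t ht]
    · have : (0 : ℝ) ≤ B * T := by positivity
      push_cast
      simp only [sub_zero, zero_sub, neg_neg, max_self]
      nlinarith
  exact hPL.exists_eq_forall_mem_Icc_hasDerivWithinAt₀

/-- A perturbation of the identity by a strict contraction is onto. -/
theorem surjective_of_norm_sub_sub_le {V : Type*} [NormedAddCommGroup V] [CompleteSpace V]
    {f : V → V} {c : ℝ} (hc : c < 1) (hc0 : 0 ≤ c)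
    (hf : ∀ x y, ‖f x - f y - (x - y)‖ ≤ c * ‖x - y‖) :
    Function.Surjective f := by
  intro y
  lift c to ℝ≥0 using hc0
  have hK : ContractingWith c fun x => x - f x + y := by
    refine ⟨by exact_mod_cast hc, LipschitzWith.of_dist_le_mul fun a b => ?_⟩
    have h : a - f a + y - (b - f b + y) = -(f a - f b - (a - b)) := by abel
    rw [dist_eq_norm, dist_eq_norm, h, norm_neg]
    exact hf a b
  refine ⟨hK.fixedPoint, ?_⟩
  have := hK.fixedPoint_isFixedPt
  simp only [Function.IsFixedPt] at this
  rw [sub_add_eq_add_sub, sub_eq_iff_eq_add] at this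
  exact (add_left_cancel this).symm

/-- Joint differentiability of `u` at a point of a curve along which `u` is differentiable and
around which `u (s, ·)` has a uniform quadratic expansion. -/
theorem hasFDerivAt_of_quadratic_expansion_along_curve {E : Type*} [NormedAddCommGroup E]
    [InnerProductSpace ℝ E] {u : ℝ × E → ℝ} {c π : ℝ → E} {v : E} {t g C : ℝ}
    (hc : HasDerivAt c v t) (hg : HasDerivAt (fun s => u (s, c s)) g t)
    (hπ : ContinuousAt π t)
    (hu : ∀ᶠ s in 𝓝 t, ∀ y, |u (s, y) - u (s, c s) - ⟪π s, y - c s⟫| ≤ C * ‖y - c s‖ ^ 2) :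
    HasFDerivAt u (innerSL ℝ (π t) ∘L ContinuousLinearMap.snd ℝ ℝ E -
      (⟪π t, v⟫ - g) • ContinuousLinearMap.fst ℝ ℝ E) (t, c t) := by
  set z₀ : ℝ × E := (t, c t) with hz₀
  have hfst : Tendsto (Prod.fst : ℝ × E → ℝ) (𝓝 z₀) (𝓝 t) := continuous_fst.tendsto z₀
  have hw : HasFDerivAt (fun z : ℝ × E => z.2 - c z.1) (ContinuousLinearMap.snd ℝ ℝ E -
      (ContinuousLinearMap.toSpanSingleton ℝ v) ∘L ContinuousLinearMap.fst ℝ ℝ E) z₀ :=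
    hasFDerivAt_snd.sub (hc.hasFDerivAt.comp z₀ hasFDerivAt_fst)
  have hw0 : (fun z : ℝ × E => z.2 - c z.1) z₀ = 0 := sub_self _
  have hwO : (fun z : ℝ × E => z.2 - c z.1) =O[𝓝 z₀] fun z => z - z₀ := by
    simpa [hw0] using hw.isBigO_sub
  have hwlim : Tendsto (fun z : ℝ × E => z.2 - c z.1) (𝓝 z₀) (𝓝 0) := by
    simpa only [hw0] using hw.continuousAt.tendsto
  have hG : HasFDerivAt (fun z : ℝ × E => u (z.1, c z.1) + ⟪π t, z.2 - c z.1⟫)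
      (innerSL ℝ (π t) ∘L ContinuousLinearMap.snd ℝ ℝ E -
        (⟪π t, v⟫ - g) • ContinuousLinearMap.fst ℝ ℝ E) z₀ := by
    have h1 := (hg.hasFDerivAt.comp z₀ hasFDerivAt_fst).add
      ((innerSL ℝ (π t)).hasFDerivAt.comp z₀ hw)
    refine h1.congr_fderiv ?_
    ext x <;> simp [sub_eq_add_neg]
  have hR : HasFDerivAt (fun z : ℝ × E => u z - (u (z.1, c z.1) + ⟪π t, z.2 - c z.1⟫))
      (0 : ℝ × E →L[ℝ] ℝ) z₀ := by
    rw [hasFDerivAt_iff_isLittleO]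
    simp only [hz₀, sub_self, inner_zero_right, add_zero, sub_zero, zero_apply]
    rw [← hz₀]
    have hsmall : (fun z : ℝ × E => C * ‖z.2 - c z.1‖ + ‖π z.1 - π t‖) =o[𝓝 z₀]
        fun _ => (1 : ℝ) := by
      rw [isLittleO_one_iff]
      have h1 : Tendsto (fun z : ℝ × E => π z.1 - π t) (𝓝 z₀) (𝓝 0) := by
        simpa using (hπ.tendsto.comp hfst).sub_const (π t)
      simpa using (hwlim.norm.const_mul C).add h1.norm
    have hprod := hsmall.mul_isBigO hwO.norm_norm
    simp only [one_mul] at hprod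
    refine IsBigO.trans_isLittleO (IsBigO.of_bound 1 ?_) hprod.of_norm_right
    filter_upwards [hfst.eventually hu] with z hz
    rw [one_mul, Real.norm_eq_abs, Real.norm_eq_abs]
    have h1 := hz z.2
    have h2 : |⟪π z.1 - π t, z.2 - c z.1⟫| ≤ ‖π z.1 - π t‖ * ‖z.2 - c z.1‖ :=
      abs_real_inner_le_norm _ _
    have h3 : u z - (u (z.1, c z.1) + ⟪π t, z.2 - c z.1⟫) =
        (u (z.1, z.2) - u (z.1, c z.1) - ⟪π z.1, z.2 - c z.1⟫) +
          ⟪π z.1 - π t, z.2 - c z.1⟫ := by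
      rw [inner_sub_left]
      ring
    rw [h3]
    refine (abs_add_le _ _).trans (le_trans ?_ (le_abs_self _))
    linarith
  refine ((hG.add hR).congr_fderiv (add_zero _)).congr_of_eventuallyEq (Eventually.of_forall ?_)
  intro z
  simp

end Calculus

section Characteristics

variable {E : Type*} [NormedAddCommGroup E] [InnerProductSpace ℝ E] [CompleteSpace E]

/-- The Hamiltonian vector field `(∂_p F, -∂_q F)`. -/
noncomputable def hamiltonianField (F : ℝ × E × E → ℝ) (t : ℝ) (z : E × E) : E × E :=
  ((toDual ℝ E).symm (fderiv ℝ F (t, z) ∘L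
      (ContinuousLinearMap.inr ℝ ℝ (E × E) ∘L ContinuousLinearMap.inr ℝ E E)),
    -(toDual ℝ E).symm (fderiv ℝ F (t, z) ∘L
      (ContinuousLinearMap.inr ℝ ℝ (E × E) ∘L ContinuousLinearMap.inl ℝ E E)))

theorem fderiv_apply_eq_hamiltonianField (F : ℝ × E × E → ℝ) (t : ℝ) (z w : E × E) :
    fderiv ℝ F (t, z) (0, w) =
      ⟪(hamiltonianField F t z).1, w.2⟫ - ⟪(hamiltonianField F t z).2, w.1⟫ := by
  have h : ((0 : ℝ), w) = (0, w.1, 0) + (0, 0, w.2) := by simp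
  rw [h, map_add]
  simp [hamiltonianField, add_comm]

theorem norm_hamiltonianField_sub_le (F : ℝ × E × E → ℝ) (t s : ℝ) (z w : E × E) :
    ‖hamiltonianField F t z - hamiltonianField F s w‖ ≤
      ‖fderiv ℝ F (t, z) - fderiv ℝ F (s, w)‖ := by
  have key : ∀ J : E →L[ℝ] ℝ × E × E, (∀ v, ‖J v‖ ≤ ‖v‖) →
      ‖(toDual ℝ E).symm (fderiv ℝ F (t, z) ∘L J) - (toDual ℝ E).symm (fderiv ℝ F (s, w) ∘L J)‖ ≤
        ‖fderiv ℝ F (t, z) - fderiv ℝ F (s, w)‖ := by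
    intro J hJ
    rw [← map_sub, LinearIsometryEquiv.norm_map, ← ContinuousLinearMap.sub_comp]
    refine ContinuousLinearMap.opNorm_le_bound _ (norm_nonneg (fderiv ℝ F (t, z) - fderiv ℝ F (s, w))) fun v => ?_
    exact ((fderiv ℝ F (t, z) - fderiv ℝ F (s, w)).le_opNorm (J v)).trans
      (mul_le_mul_of_nonneg_left (hJ v) (norm_nonneg _))
  refine max_le (key _ fun v => by simp [Prod.norm_def]) ?_
  rw [hamiltonianField, hamiltonianField, Prod.snd_sub, neg_sub_neg, norm_sub_rev]
  exact key _ fun v => by simp [Prod.norm_def]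

theorem continuous_hamiltonianField {F : ℝ × E × E → ℝ} (hF : Continuous (fderiv ℝ F)) :
    Continuous fun x : ℝ × E × E => hamiltonianField F x.1 x.2 := by
  unfold hamiltonianField
  fun_prop

/-- The characteristics of the Cauchy problem `∂ₜu + F(t, q, ∂_q u) = 0`, `u(0, ·) = u₀`, on the
time interval `[-T, T]`, together with the action along them: `Z q` is the characteristic
starting from `(q, ∇u₀(q))`. -/
structure IsCharacteristicFamily (F : ℝ × E × E → ℝ) (u₀ : E → ℝ) (T : ℝ)
    (Z : E → ℝ → E × E) (A : E → ℝ → ℝ) : Prop where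
  initial : ∀ q, Z q 0 = (q, gradient u₀ q)
  action_init : ∀ q, A q 0 = u₀ q
  hasDerivWithinAt : ∀ q, ∀ t ∈ Icc (-T) T,
    HasDerivWithinAt (Z q) (hamiltonianField F t (Z q t)) (Icc (-T) T) t
  action_hasDerivWithinAt : ∀ q, ∀ t ∈ Icc (-T) T,
    HasDerivWithinAt (A q) (⟪(Z q t).2, (hamiltonianField F t (Z q t)).1⟫ - F (t, Z q t))
      (Icc (-T) T) t

variable {F : ℝ × E × E → ℝ} {u₀ : E → ℝ} {M L T : ℝ}

theorem norm_hamiltonianField_sub_le_mul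
    (hlip : ∀ x y, ‖fderiv ℝ F y - fderiv ℝ F x‖ ≤ M * ‖y - x‖) (t : ℝ) (z w : E × E) :
    ‖hamiltonianField F t z - hamiltonianField F t w‖ ≤ M * ‖z - w‖ := by
  refine (norm_hamiltonianField_sub_le F t t z w).trans ((hlip _ _).trans_eq ?_)
  simp [Prod.norm_def]

/-- Standing assumptions on the Hamiltonian `F`, the initial datum `u₀` and the time `T`. -/
structure IsShortTimeData (F : ℝ × E × E → ℝ) (u₀ : E → ℝ) (M L T : ℝ) : Prop where
  time_nonneg : 0 ≤ T
  nonneg : 0 ≤ M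
  lip_nonneg : 0 ≤ L
  mul_le : M * T * (1 + L) ≤ 1 / 4
  contDiff : ContDiff ℝ 1 F
  norm_fderiv_sub_le : ∀ x y, ‖fderiv ℝ F y - fderiv ℝ F x‖ ≤ M * ‖y - x‖
  differentiable : Differentiable ℝ u₀
  norm_gradient_sub_le : ∀ q q', ‖gradient u₀ q' - gradient u₀ q‖ ≤ L * ‖q' - q‖

theorem IsShortTimeData.mul_time_le (hD : IsShortTimeData F u₀ M L T) : M * T ≤ 1 / 4 := by
  have := mul_nonneg (mul_nonneg hD.nonneg hD.time_nonneg) hD.lip_nonneg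
  linarith [hD.mul_le]

/-- The factor by which the characteristics are displaced up to time `t ∈ [-T, T]`. -/
theorem IsShortTimeData.displacement_le (hD : IsShortTimeData F u₀ M L T) {t : ℝ}
    (ht : t ∈ Icc (-T) T) : M * |t| * (1 + L) ≤ 1 / 4 := by
  have h1 := hD.nonneg
  have h2 := hD.lip_nonneg
  have h3 : |t| ≤ T := abs_le.2 ht
  exact le_trans (by gcongr) hD.mul_le

theorem exists_isCharacteristicFamily (hD : IsShortTimeData F u₀ M L T) :
    ∃ Z A, IsCharacteristicFamily F u₀ T Z A := by
  have hX := continuous_hamiltonianField (hD.contDiff.continuous_fderiv one_ne_zero)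
  choose Z hZ0 hZ using fun q => exists_integralCurve_on_Icc hD.time_nonneg
    hD.nonneg hD.mul_time_le
    (norm_hamiltonianField_sub_le_mul hD.norm_fderiv_sub_le) (fun z => hX.comp (continuous_id.prodMk continuous_const)) (q, gradient u₀ q)
  have hZc : ∀ q, ContinuousOn (Z q) (Icc (-T) T) := fun q t ht => (hZ q t ht).continuousWithinAt
  have hf : ∀ q, ContinuousOn
      (fun t => ⟪(Z q t).2, (hamiltonianField F t (Z q t)).1⟫ - F (t, Z q t)) (Icc (-T) T) := by
    intro q
    have h1 : ContinuousOn (fun t => (t, Z q t)) (Icc (-T) T) := continuousOn_id.prodMk (hZc q)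
    have h2 : ContinuousOn (fun t => hamiltonianField F t (Z q t)) (Icc (-T) T) :=
      hX.comp_continuousOn h1
    exact ((hZc q).snd.inner h2.fst).sub (hD.contDiff.continuous.comp_continuousOn h1)
  choose A hA0 hA using fun q => exists_primitive_on_Icc hD.time_nonneg (hf q) (u₀ q)
  exact ⟨Z, A, hZ0, hA0, hZ, hA⟩

namespace IsCharacteristicFamily

variable {Z : E → ℝ → E × E} {A : E → ℝ → ℝ}

theorem continuousOn (h : IsCharacteristicFamily F u₀ T Z A) (q : E) :
    ContinuousOn (Z q) (Icc (-T) T) :=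
  fun t ht => (h.hasDerivWithinAt q t ht).continuousWithinAt

theorem hasDerivWithinAt_fst (h : IsCharacteristicFamily F u₀ T Z A) (q : E) {t : ℝ}
    (ht : t ∈ Icc (-T) T) : HasDerivWithinAt (fun s => (Z q s).1)
      (hamiltonianField F t (Z q t)).1 (Icc (-T) T) t := by
  simpa using (h.hasDerivWithinAt q t ht).hasFDerivWithinAt.fst.hasDerivWithinAt

theorem hasDerivWithinAt_snd (h : IsCharacteristicFamily F u₀ T Z A) (q : E) {t : ℝ}
    (ht : t ∈ Icc (-T) T) : HasDerivWithinAt (fun s => (Z q s).2)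
      (hamiltonianField F t (Z q t)).2 (Icc (-T) T) t := by
  simpa using (h.hasDerivWithinAt q t ht).hasFDerivWithinAt.snd.hasDerivWithinAt

theorem norm_init_sub_le (h : IsCharacteristicFamily F u₀ T Z A)
    (hD : IsShortTimeData F u₀ M L T) (q q' : E) :
    ‖Z q' 0 - Z q 0‖ ≤ (1 + L) * ‖q' - q‖ := by
  rw [h.initial, h.initial]
  have h1 := mul_nonneg hD.lip_nonneg (norm_nonneg (q' - q))
  exact max_le (by simp only [Prod.fst_sub]; linarith)
    (by simp only [Prod.snd_sub]; linarith [hD.norm_gradient_sub_le q q', norm_nonneg (q' - q)])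

theorem norm_displacement_le (h : IsCharacteristicFamily F u₀ T Z A)
    (hD : IsShortTimeData F u₀ M L T) {t : ℝ} (ht : t ∈ Icc (-T) T) (q q' : E) :
    ‖Z q' t - Z q t - (Z q' 0 - Z q 0)‖ ≤ 4 / 3 * (M * |t| * (1 + L)) * ‖q' - q‖ ∧
      ‖Z q' t - Z q t‖ ≤ 4 / 3 * (1 + L) * ‖q' - q‖ := by
  have key := norm_sub_le_of_norm_deriv_le_mul_norm hD.nonneg hD.mul_time_le
    (fun s hs => (h.hasDerivWithinAt q' s hs).sub (h.hasDerivWithinAt q s hs))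
    (fun s hs => norm_hamiltonianField_sub_le_mul hD.norm_fderiv_sub_le s _ _) ht
  have h0 := h.norm_init_sub_le hD q q'
  have hM := hD.nonneg
  simp only [Pi.sub_apply] at key
  constructor
  · refine key.1.trans ((mul_le_mul_of_nonneg_left h0 (by positivity)).trans_eq (by ring))
  · exact key.2.trans (by linarith)

theorem norm_fst_displacement_le (h : IsCharacteristicFamily F u₀ T Z A)
    (hD : IsShortTimeData F u₀ M L T) {t : ℝ} (ht : t ∈ Icc (-T) T) (q q' : E) :
    ‖(Z q' t).1 - (Z q t).1 - (q' - q)‖ ≤ 4 / 3 * (M * |t| * (1 + L)) * ‖q' - q‖ := by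
  have h1 := (norm_fst_le _).trans (h.norm_displacement_le hD ht q q').1
  simpa [h.initial] using h1

theorem norm_sub_le_norm_fst_sub (h : IsCharacteristicFamily F u₀ T Z A)
    (hD : IsShortTimeData F u₀ M L T) {t : ℝ} (ht : t ∈ Icc (-T) T) (q q' : E) :
    (1 - 4 / 3 * (M * |t| * (1 + L))) * ‖q' - q‖ ≤ ‖(Z q' t).1 - (Z q t).1‖ := by
  have h1 := h.norm_fst_displacement_le hD ht q q'
  have h2 := norm_sub_norm_le (q' - q) ((Z q' t).1 - (Z q t).1)
  rw [norm_sub_rev (q' - q)] at h2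
  linarith

theorem norm_sub_le (h : IsCharacteristicFamily F u₀ T Z A)
    (hD : IsShortTimeData F u₀ M L T) {t : ℝ} (ht : t ∈ Icc (-T) T) (q q' : E) :
    ‖q' - q‖ ≤ 3 / 2 * ‖(Z q' t).1 - (Z q t).1‖ := by
  have h1 := h.norm_sub_le_norm_fst_sub hD ht q q'
  nlinarith [hD.displacement_le ht, norm_nonneg (q' - q)]

theorem norm_snd_sub_le (h : IsCharacteristicFamily F u₀ T Z A)
    (hD : IsShortTimeData F u₀ M L T) {t : ℝ} (ht : t ∈ Icc (-T) T) (q q' : E) :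
    ‖(Z q' t).2 - (Z q t).2‖ ≤
      (L + 4 * |t| * M * (1 + L) ^ 2) * ‖(Z q' t).1 - (Z q t).1‖ := by
  have h1 := (norm_snd_le _).trans (h.norm_displacement_le hD ht q q').1
  have h2 : ‖(Z q' t).2 - (Z q t).2‖ ≤
      ‖(Z q' t).2 - (Z q t).2 - (gradient u₀ q' - gradient u₀ q)‖ +
        ‖gradient u₀ q' - gradient u₀ q‖ := by
    simpa using norm_add_le ((Z q' t).2 - (Z q t).2 - (gradient u₀ q' - gradient u₀ q))
      (gradient u₀ q' - gradient u₀ q)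
  have h3 := h.norm_sub_le_norm_fst_sub hD ht q q'
  have h4 := hD.norm_gradient_sub_le q q'
  have hM := hD.nonneg
  have hL := hD.lip_nonneg
  simp only [h.initial, Prod.snd_sub] at h1
  have hx := hD.displacement_le ht
  have hx0 : 0 ≤ M * |t| * (1 + L) := by positivity
  set x := M * |t| * (1 + L) with hxdef
  have h5 : ‖(Z q' t).2 - (Z q t).2‖ ≤ (L + 4 / 3 * x) * ‖q' - q‖ := by linarith
  have h6 : L + 4 / 3 * x ≤ (L + 4 * x * (1 + L)) * (1 - 4 / 3 * x) := by
    nlinarith [mul_nonneg hx0 (by linarith : 0 ≤ 1 + L)]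
  have h7 : L + 4 * |t| * M * (1 + L) ^ 2 = L + 4 * x * (1 + L) := by rw [hxdef]; ring
  have h8 : 0 ≤ L + 4 * x * (1 + L) := by positivity
  rw [h7]
  calc ‖(Z q' t).2 - (Z q t).2‖ ≤ (L + 4 / 3 * x) * ‖q' - q‖ := h5
    _ ≤ (L + 4 * x * (1 + L)) * (1 - 4 / 3 * x) * ‖q' - q‖ := by gcongr
    _ = (L + 4 * x * (1 + L)) * ((1 - 4 / 3 * x) * ‖q' - q‖) := by ring
    _ ≤ _ := by gcongr

theorem surjective_fst (h : IsCharacteristicFamily F u₀ T Z A)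
    (hD : IsShortTimeData F u₀ M L T) {t : ℝ} (ht : t ∈ Icc (-T) T) :
    Function.Surjective fun q => (Z q t).1 := by
  have hM := hD.nonneg
  have hL := hD.lip_nonneg
  exact surjective_of_norm_sub_sub_le (by linarith [hD.displacement_le ht]) (by positivity)
    fun x y => h.norm_fst_displacement_le hD ht y x

/-- The action is, at each time, quadratically close to its linearization by the momentum. -/
theorem exists_abs_action_sub_le (h : IsCharacteristicFamily F u₀ T Z A)
    (hD : IsShortTimeData F u₀ M L T) : ∃ C, ∀ t ∈ Icc (-T) T, ∀ q q' : E,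
      |A q' t - A q t - ⟪(Z q t).2, (Z q' t).1 - (Z q t).1⟫| ≤
        C * ‖(Z q' t).1 - (Z q t).1‖ ^ 2 := by
  have hM := hD.nonneg
  have hL := hD.lip_nonneg
  have hT := hD.time_nonneg
  set N := 2 * M * (4 / 3 * (1 + L)) ^ 2 with hN
  refine ⟨(N * T + L) * (3 / 2) ^ 2, fun t ht q q' => ?_⟩
  have hderiv : ∀ s ∈ Icc (-T) T, HasDerivWithinAt
      (fun s => A q' s - A q s - ⟪(Z q s).2, (Z q' s).1 - (Z q s).1⟫) _ (Icc (-T) T) s :=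
    fun s hs => ((h.action_hasDerivWithinAt q' s hs).sub (h.action_hasDerivWithinAt q s hs)).sub
      ((h.hasDerivWithinAt_snd q hs).inner ℝ
        ((h.hasDerivWithinAt_fst q' hs).sub (h.hasDerivWithinAt_fst q hs)))
  have h0I : (0 : ℝ) ∈ Icc (-T) T := by simp [hT]
  have hmv := (convex_Icc (-T) T).norm_image_sub_le_of_norm_hasDerivWithin_le
    (C := N * ‖q' - q‖ ^ 2) hderiv (fun s hs => ?_) h0I ht
  · have hinit : |u₀ q' - u₀ q - ⟪gradient u₀ q, q' - q⟫| ≤ L * ‖q' - q‖ ^ 2 := by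
      have hg : ∀ x, fderiv ℝ u₀ x = toDual ℝ E (gradient u₀ x) := fun x => by simp [gradient]
      have := abs_taylor_remainder_le hD.differentiable hL
        (fun x y => by
          rw [hg, hg, ← map_sub, LinearIsometryEquiv.norm_map]
          exact hD.norm_gradient_sub_le x y) q q'
      rwa [hg, toDual_apply_apply] at this
    have ht' : ‖t - 0‖ ≤ T := by simpa using abs_le.2 ht
    have hq := h.norm_sub_le hD ht q q'
    simp only [h.initial, h.action_init] at hmv
    have hNq : 0 ≤ N * ‖q' - q‖ ^ 2 := by positivity
    have h1 := abs_sub_abs_le_abs_sub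
      (A q' t - A q t - ⟪(Z q t).2, (Z q' t).1 - (Z q t).1⟫)
      (u₀ q' - u₀ q - ⟪gradient u₀ q, q' - q⟫)
    rw [Real.norm_eq_abs] at hmv
    calc _ ≤ N * ‖q' - q‖ ^ 2 * T + L * ‖q' - q‖ ^ 2 := by
          have := mul_le_mul_of_nonneg_left ht' hNq
          linarith
      _ = (N * T + L) * ‖q' - q‖ ^ 2 := by ring
      _ ≤ (N * T + L) * (3 / 2 * ‖(Z q' t).1 - (Z q t).1‖) ^ 2 := by gcongr
      _ = _ := by ring
  · have hz := (h.norm_displacement_le hD hs q q').2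
    set z := Z q s
    set w := Z q' s
    have htay := abs_taylor_remainder_le (hD.contDiff.differentiable one_ne_zero) hM
      hD.norm_fderiv_sub_le (s, z) (s, w)
    have hsub : ((s, w) - (s, z) : ℝ × E × E) = (0, w - z) := by simp
    have hnorm : ‖((0 : ℝ), w - z)‖ = ‖w - z‖ := by simp [Prod.norm_def]
    rw [hsub, fderiv_apply_eq_hamiltonianField, hnorm] at htay
    have hinner : |⟪w.2 - z.2, (hamiltonianField F s w).1 - (hamiltonianField F s z).1⟫| ≤
        M * ‖w - z‖ ^ 2 := by
      have h1 : ‖w.2 - z.2‖ ≤ ‖w - z‖ := norm_snd_le (w - z)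
      have h2 := (norm_fst_le _).trans
        (norm_hamiltonianField_sub_le_mul hD.norm_fderiv_sub_le s w z)
      calc _ ≤ _ := abs_real_inner_le_norm _ _
        _ ≤ ‖w - z‖ * (M * ‖w - z‖) := mul_le_mul h1 h2 (norm_nonneg _) (norm_nonneg _)
        _ = _ := by ring
    have hfin : M * ‖w - z‖ ^ 2 + M * ‖w - z‖ ^ 2 ≤ N * ‖q' - q‖ ^ 2 := by
      calc _ = 2 * M * ‖w - z‖ ^ 2 := by ring
        _ ≤ 2 * M * (4 / 3 * (1 + L) * ‖q' - q‖) ^ 2 := by gcongr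
        _ = _ := by rw [hN]; ring
    refine le_trans ?_ hfin
    refine le_trans (le_of_eq ?_) ((abs_sub _ _).trans (add_le_add hinner htay))
    rw [Real.norm_eq_abs]
    congr 1
    simp only [inner_sub_left, inner_sub_right, Prod.fst_sub, Prod.snd_sub]
    rw [real_inner_comm (hamiltonianField F s z).1 w.2,
      real_inner_comm (hamiltonianField F s z).1 z.2]
    ring

/-- Characteristics starting from a bounded set are uniformly Lipschitz in time. -/
theorem exists_norm_sub_le_mul_abs (h : IsCharacteristicFamily F u₀ T Z A)
    (hD : IsShortTimeData F u₀ M L T) (R : ℝ) : ∃ B, 0 ≤ B ∧ ∀ q : E, ‖q‖ ≤ R →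
      ∀ t ∈ Icc (-T) T, ∀ s ∈ Icc (-T) T, ‖Z q t - Z q s‖ ≤ B * |t - s| := by
  have hM := hD.nonneg
  have hL := hD.lip_nonneg
  have hT := hD.time_nonneg
  have hX := continuous_hamiltonianField (hD.contDiff.continuous_fderiv one_ne_zero)
  have hc : ContinuousOn (fun t => hamiltonianField F t (Z 0 t)) (Icc (-T) T) :=
    hX.comp_continuousOn (continuousOn_id.prodMk (h.continuousOn 0))
  obtain ⟨B, hB⟩ := isCompact_Icc.exists_bound_of_continuousOn hc
  have hB0 : 0 ≤ B := (norm_nonneg _).trans (hB 0 (by simp [hT]))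
  refine ⟨B + M * (4 / 3 * (1 + L) * |R|), by positivity, fun q hq t ht s hs => ?_⟩
  refine (convex_Icc (-T) T).norm_image_sub_le_of_norm_hasDerivWithin_le
    (h.hasDerivWithinAt q) (fun r hr => ?_) hs ht
  have h1 := (h.norm_displacement_le hD hr 0 q).2
  have h2 := norm_hamiltonianField_sub_le_mul hD.norm_fderiv_sub_le r (Z q r) (Z 0 r)
  have h3 : ‖Z q r - Z 0 r‖ ≤ 4 / 3 * (1 + L) * |R| := by
    refine h1.trans ?_
    rw [sub_zero]
    gcongr
    exact hq.trans (le_abs_self R)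
  have h4 := norm_add_le (hamiltonianField F r (Z q r) - hamiltonianField F r (Z 0 r))
    (hamiltonianField F r (Z 0 r))
  rw [sub_add_cancel] at h4
  have h5 := mul_le_mul_of_nonneg_left h3 hM
  linarith [hB r hr]

end IsCharacteristicFamily

/-- A short-time solution `u` of the Cauchy problem, with its spatial gradient `p`. -/
theorem IsShortTimeData.exists_solution (hD : IsShortTimeData F u₀ M L T) :
    ∃ (u : ℝ × E → ℝ) (p : ℝ × E → E), (∀ q, u (0, q) = u₀ q) ∧
      (∀ z : ℝ × E, z.1 ∈ Ioo (-T) T →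
        HasFDerivAt u (innerSL ℝ (p z) ∘L ContinuousLinearMap.snd ℝ ℝ E -
          F (z.1, z.2, p z) • ContinuousLinearMap.fst ℝ ℝ E) z) ∧
      (∀ t ∈ Icc (-T) T, ∀ q q' : E,
        ‖p (t, q') - p (t, q)‖ ≤ (L + 4 * |t| * M * (1 + L) ^ 2) * ‖q' - q‖) ∧
      ∀ z : ℝ × E, z.1 ∈ Ioo (-T) T → ∃ K : ℝ≥0, ∃ U ∈ 𝓝 z, LipschitzOnWith K p U := by
  obtain ⟨Z, A, h⟩ := exists_isCharacteristicFamily hD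
  obtain ⟨C, hC⟩ := h.exists_abs_action_sub_le hD
  have hM := hD.nonneg
  have hL := hD.lip_nonneg
  have hT := hD.time_nonneg
  have hsurj : ∀ z : ℝ × E, ∃ q, z.1 ∈ Icc (-T) T → (Z q z.1).1 = z.2 := by
    intro z
    by_cases hz : z.1 ∈ Icc (-T) T
    · exact (h.surjective_fst hD hz z.2).imp fun q hq _ => hq
    · exact ⟨0, fun hz' => absurd hz' hz⟩
  choose Y hY using hsurj
  have hYZ : ∀ t ∈ Icc (-T) T, ∀ q, Y (t, (Z q t).1) = q := by
    intro t ht q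
    have h1 := h.norm_sub_le hD ht q (Y (t, (Z q t).1))
    rw [hY _ ht, sub_self, norm_zero, mul_zero] at h1
    exact sub_eq_zero.1 (norm_le_zero_iff.1 h1)
  have hlip : ∀ t ∈ Icc (-T) T, ∀ q q' : E,
      ‖(Z (Y (t, q')) t).2 - (Z (Y (t, q)) t).2‖ ≤
        (L + 4 * |t| * M * (1 + L) ^ 2) * ‖q' - q‖ := by
    intro t ht q q'
    have h1 := h.norm_snd_sub_le hD ht (Y (t, q)) (Y (t, q'))
    rwa [hY _ ht, hY _ ht] at h1
  refine ⟨fun z => A (Y z) z.1, fun z => (Z (Y z) z.1).2, fun q => ?_, ?_, hlip, ?_⟩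
  · have h1 := hYZ 0 (by simp [hT]) q
    rw [h.initial] at h1
    simp only at h1 ⊢
    rw [h1, h.action_init]
  · rintro ⟨t, x⟩ ht
    have htI := Ioo_subset_Icc_self ht
    have hI : Icc (-T) T ∈ 𝓝 t := Icc_mem_nhds ht.1 ht.2
    set q := Y (t, x) with hq
    have hx : (Z q t).1 = x := hY (t, x) htI
    have hu : (fun s => A (Y (s, (Z q s).1)) s) =ᶠ[𝓝 t] A q := by
      filter_upwards [hI] with s hs
      rw [hYZ s hs]
    have hfd := hasFDerivAt_of_quadratic_expansion_along_curve
      (u := fun z => A (Y z) z.1) (C := C)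
      ((h.hasDerivWithinAt_fst q htI).hasDerivAt hI)
      (((h.action_hasDerivWithinAt q t htI).hasDerivAt hI).congr_of_eventuallyEq hu)
      ((h.hasDerivWithinAt_snd q htI).hasDerivAt hI).continuousAt (by
        filter_upwards [hI] with s hs y
        have h1 := hC s hs q (Y (s, y))
        rw [hY (s, y) hs] at h1
        simpa only [hYZ s hs] using h1)
    have hz : (t, (Z q t).1) = (t, x) := by rw [hx]
    have hF : F (t, Z q t) = F (t, x, (Z q t).2) := by rw [← hx]
    rw [hz, sub_sub_cancel, hF] at hfd
    exact hfd
  · rintro ⟨t₀, x₀⟩ ht₀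
    obtain ⟨D, hDb⟩ := isCompact_Icc.exists_bound_of_continuousOn (h.continuousOn 0)
    have hYb : ∀ z : ℝ × E, z.1 ∈ Icc (-T) T → ‖Y z‖ ≤ 3 / 2 * (‖z.2‖ + D) := by
      intro z hz
      have h1 := h.norm_sub_le hD hz 0 (Y z)
      rw [hY z hz, sub_zero] at h1
      have h2 := norm_sub_le z.2 (Z 0 z.1).1
      have h3 := (norm_fst_le (Z 0 z.1)).trans (hDb z.1 hz)
      linarith
    obtain ⟨B, hB0, hB⟩ := h.exists_norm_sub_le_mul_abs hD (3 / 2 * (‖x₀‖ + 1 + D))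
    set K := L + 4 * T * M * (1 + L) ^ 2 with hK
    have hK0 : 0 ≤ K := by positivity
    refine ⟨(K + K * B + B).toNNReal, Ioo (-T) T ×ˢ ball x₀ 1,
      prod_mem_nhds (Ioo_mem_nhds ht₀.1 ht₀.2) (ball_mem_nhds _ one_pos), ?_⟩
    refine LipschitzOnWith.of_dist_le_mul fun z' hz' z hz => ?_
    rw [Real.coe_toNNReal _ (by positivity), dist_eq_norm, dist_eq_norm]
    have hzI := Ioo_subset_Icc_self hz.1
    have hzI' := Ioo_subset_Icc_self hz'.1
    have hq : ‖Y z‖ ≤ 3 / 2 * (‖x₀‖ + 1 + D) := by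
      refine (hYb z hzI).trans ?_
      have h1 : ‖z.2 - x₀‖ < 1 := by simpa [dist_eq_norm] using hz.2
      have h2 := norm_add_le (z.2 - x₀) x₀
      rw [sub_add_cancel] at h2
      linarith
    set q := Y z
    have htime : ‖Z q z'.1 - Z q z.1‖ ≤ B * ‖z' - z‖ :=
      (hB q hq _ hzI' _ hzI).trans (mul_le_mul_of_nonneg_left (norm_fst_le (z' - z)) hB0)
    have hspace : ‖(Z (Y z') z'.1).2 - (Z q z'.1).2‖ ≤ K * ‖z'.2 - (Z q z'.1).1‖ := by
      have h1 := hlip z'.1 hzI' (Z q z'.1).1 z'.2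
      rw [hYZ _ hzI'] at h1
      refine h1.trans ?_
      have : |z'.1| ≤ T := abs_le.2 hzI'
      rw [hK]
      gcongr
    have hpos : ‖z'.2 - (Z q z'.1).1‖ ≤ ‖z' - z‖ + B * ‖z' - z‖ := by
      have h1 : z'.2 - (Z q z'.1).1 = (z' - z).2 - (Z q z'.1 - Z q z.1).1 := by
        simp only [Prod.snd_sub, Prod.fst_sub, q, hY z hzI]
        abel
      rw [h1]
      exact (norm_sub_le _ _).trans
        (add_le_add (norm_snd_le _) ((norm_fst_le _).trans htime))
    have hsplit := norm_add_le ((Z (Y z') z'.1).2 - (Z q z'.1).2) ((Z q z'.1).2 - (Z q z.1).2)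
    rw [sub_add_sub_cancel] at hsplit
    have htime2 : ‖(Z q z'.1).2 - (Z q z.1).2‖ ≤ B * ‖z' - z‖ :=
      (norm_snd_le (Z q z'.1 - Z q z.1)).trans htime
    have := mul_le_mul_of_nonneg_left hpos hK0
    linarith

end Characteristics

/-- Local existence of a `C^{1,1}_loc` solution of the Cauchy problem for the
Hamilton–Jacobi equation, for a `C²` Hamiltonian with `‖d²H‖ ≤ M`, on the time interval
`(-T, T)` with `T = (4M(1 + Lip(du₀)))⁻¹`, together with the Lipschitz estimate
`Lip(du_t) ≤ Lip(du₀) + 4|t|M(1 + Lip(du₀))²`. -/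
theorem local_existence_for_HJ {d : ℕ}
    (H : ℝ → EuclideanSpace ℝ (Fin d) → EuclideanSpace ℝ (Fin d) → ℝ)
    (hH : ContDiff ℝ 2 (fun x : ℝ × EuclideanSpace ℝ (Fin d) × EuclideanSpace ℝ (Fin d) =>
      H x.1 x.2.1 x.2.2))
    (M : ℝ) (hM : 0 < M)
    -- Hypothesis 1: `‖d²H‖ ≤ M` everywhere
    (hd2H : ∀ x : ℝ × EuclideanSpace ℝ (Fin d) × EuclideanSpace ℝ (Fin d),
      ‖iteratedFDeriv ℝ 2
        (fun y : ℝ × EuclideanSpace ℝ (Fin d) × EuclideanSpace ℝ (Fin d) =>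
          H y.1 y.2.1 y.2.2) x‖ ≤ M)
    (u₀ : EuclideanSpace ℝ (Fin d) → ℝ)
    (hu₀ : Differentiable ℝ u₀)
    (L : ℝ) (hL : 0 ≤ L)
    -- `L` is a Lipschitz constant of `du₀`
    (hu₀lip : ∀ q q' : EuclideanSpace ℝ (Fin d),
      ‖gradient u₀ q' - gradient u₀ q‖ ≤ L * ‖q' - q‖) :
    ∃ u : ℝ × EuclideanSpace ℝ (Fin d) → ℝ,
      -- initial condition
      (∀ q, u (0, q) = u₀ q) ∧
      -- `u` is differentiable on `(-T, T) × ℝᵈ` ...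
      (∀ z : ℝ × EuclideanSpace ℝ (Fin d),
        z.1 ∈ Ioo (-(4 * M * (1 + L))⁻¹) (4 * M * (1 + L))⁻¹ → DifferentiableAt ℝ u z) ∧
      -- ... with locally Lipschitz differential
      (∀ z : ℝ × EuclideanSpace ℝ (Fin d),
        z.1 ∈ Ioo (-(4 * M * (1 + L))⁻¹) (4 * M * (1 + L))⁻¹ →
        ∃ ε > 0, ball z ε ⊆
            Ioo (-(4 * M * (1 + L))⁻¹) (4 * M * (1 + L))⁻¹ ×ˢ
              (univ : Set (EuclideanSpace ℝ (Fin d))) ∧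
          ∃ K : ℝ≥0, LipschitzOnWith K (fun w => fderiv ℝ u w) (ball z ε)) ∧
      -- `u` solves the Hamilton–Jacobi equation on `(-T, T) × ℝᵈ`
      (∀ t ∈ Ioo (-(4 * M * (1 + L))⁻¹) (4 * M * (1 + L))⁻¹,
        ∀ q : EuclideanSpace ℝ (Fin d),
          deriv (fun τ => u (τ, q)) t + H t q (gradient (fun y => u (t, y)) q) = 0) ∧
      -- Lipschitz estimate on `∂_q u(t, ·)`
      (∀ t ∈ Ioo (-(4 * M * (1 + L))⁻¹) (4 * M * (1 + L))⁻¹,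
        ∀ q q' : EuclideanSpace ℝ (Fin d),
          ‖gradient (fun y => u (t, y)) q' - gradient (fun y => u (t, y)) q‖ ≤
            (L + 4 * |t| * M * (1 + L) ^ 2) * ‖q' - q‖) := by
  set F : ℝ × EuclideanSpace ℝ (Fin d) × EuclideanSpace ℝ (Fin d) → ℝ :=
    fun x => H x.1 x.2.1 x.2.2 with hF
  set T := (4 * M * (1 + L))⁻¹ with hT
  have hpos : 0 < 4 * M * (1 + L) := by positivity
  have hD : IsShortTimeData F u₀ M L T :=
    { time_nonneg := (inv_pos.2 hpos).le
      nonneg := hM.le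
      lip_nonneg := hL
      mul_le := by
        have : 4 * M * (1 + L) * T = 1 := mul_inv_cancel₀ hpos.ne'
        linarith
      contDiff := hH.of_le (by norm_num)
      norm_fderiv_sub_le := norm_fderiv_sub_le_of_norm_iteratedFDeriv_two_le hH hd2H
      differentiable := hu₀
      norm_gradient_sub_le := hu₀lip }
  obtain ⟨u, p, hinit, hderiv, hlip, hloc⟩ := hD.exists_solution
  have hgrad : ∀ t ∈ Ioo (-T) T, ∀ q, gradient (fun y => u (t, y)) q = p (t, q) := by
    intro t ht q
    refine HasGradientAt.gradient (hasGradientAt_iff_hasFDerivAt.2 ?_)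
    refine ((hderiv (t, q) ht).comp q (hasFDerivAt_prodMk_right t q)).congr_fderiv ?_
    ext y
    simp
  refine ⟨u, hinit, fun z hz => (hderiv z hz).differentiableAt, fun z hz => ?_,
    fun t ht q => ?_, fun t ht q q' => ?_⟩
  · obtain ⟨K₁, U, hU, hpU⟩ := hloc z hz
    have hΨ : ContDiff ℝ 1 fun x : ℝ × EuclideanSpace ℝ (Fin d) × EuclideanSpace ℝ (Fin d) =>
        innerSL ℝ x.2.2 ∘L ContinuousLinearMap.snd ℝ ℝ (EuclideanSpace ℝ (Fin d)) -
          F x • ContinuousLinearMap.fst ℝ ℝ (EuclideanSpace ℝ (Fin d)) := by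
      refine ContDiff.sub (ContDiff.clm_comp ?_ contDiff_const)
        (hD.contDiff.smul contDiff_const)
      exact (innerSL ℝ).contDiff.comp (by fun_prop)
    obtain ⟨K₂, W, hW, hΨW⟩ := hΨ.locallyLipschitz (z.1, z.2, p z)
    have hmap : LipschitzOnWith (max 1 (max 1 K₁)) (fun w => (w.1, w.2, p w)) U :=
      (LipschitzWith.prod_fst.lipschitzOnWith).prodMk
        ((LipschitzWith.prod_snd.lipschitzOnWith).prodMk hpU)
    have hcont : ContinuousAt (fun w => (w.1, w.2, p w)) z :=
      hmap.continuousOn.continuousAt hU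
    have hS : Ioo (-T) T ×ˢ univ ∈ 𝓝 z := prod_mem_nhds (Ioo_mem_nhds hz.1 hz.2) univ_mem
    obtain ⟨ε, hε, hball⟩ := Metric.mem_nhds_iff.1
      (inter_mem hS (inter_mem hU (hcont.preimage_mem_nhds hW)))
    refine ⟨ε, hε, fun w hw => (hball hw).1, K₂ * max 1 (max 1 K₁), ?_⟩
    have hcomp := hΨW.comp (hmap.mono fun w (hw : w ∈ ball z ε) => (hball hw).2.1)
      fun w hw => (hball hw).2.2
    intro w hw w' hw'
    simp only [(hderiv w (hball hw).1.1).fderiv, (hderiv w' (hball hw').1.1).fderiv]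
    exact hcomp hw hw'
  · have h1 := (hderiv (t, q) ht).comp_hasDerivAt t
      ((hasDerivAt_id t).prodMk (hasDerivAt_const t q))
    have h2 : deriv (fun τ => u (τ, q)) t = -H t q (p (t, q)) := by
      refine (HasDerivAt.deriv h1).trans ?_
      simp [hF]
    rw [h2, hgrad t ht]
    ring
  · rw [hgrad t ht, hgrad t ht]
    exact hlip t (Ioo_subset_Icc_self ht) q q'
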